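/- Let F be a finite field, let ℓ ≥ 1, m_A ≥ 1, m_B ≥ 1 be integers with gcd(ℓ·m_A, m_B) = 1, and let a, b be integers with a·ℓ·m_A + b·m_B = 1. Let G = (g_{i,j}) be an ℓ × ℓ matrix over F[X] satisfying: (1) g_{i,j} = 0 for all j < i; (2) deg g_{j,i} < deg g_{i,i} for all j < i; (3) g_{i,i} divides X^{m_A} − 1 for all i; (4) if g_{i,i} = X^{m_A} − 1 then g_{i,j} = 0 for all j > i. Let A be the ℓ-quasi-cyclic code of length ℓ·m_A whose codewords, written as ℓ-tuples of component polynomials in F[X]/(X^{m_A} − 1), form exactly the F[X]-submodule of (F[X]/(X^{m_A} − 1))^ℓ generated by the images of the rows of G. Let B be the cyclic code of length m_B with generator polynomial g^B, where g^B divides X^{m_B} − 1. Let R = F[X]/(X^{m_A·m_B} − 1) with X̄ the (unit) image of X, and set u = X̄^{a·ℓ·m_A}, v = X̄^{b·m_B}, w = X̄^{a·m_A}. Then the set of ℓ-tuples (c̄_0, …, c̄_{ℓ−1}) ∈ R^ℓ of (images of) component polynomials of serialized codewords of the product code A ⊗ B, where the serialization of a codeword matrix M is c(X) = Σ_{i,j}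 M_{i,j} X^{λ(i,j)} with λ(i,j) = (i·a·ℓ²·m_A + j·b·m_B) mod (ℓ·m_A·m_B) and c(X) = Σ_{h} c_h(X^ℓ) X^h, is exactly the R-submodule of R^ℓ generated by the ℓ rows r_0, …, r_{ℓ−1}, where the j-th entry of r_i is g^B(u) · g_{i,j}(v) · w^{−j}. -/

import Mathlib

set_option synthInstance.maxHeartbeats 1000000
set_option maxHeartbeats 1000000
open Polynomial

/-- `F[X]/(X^N − 1)`. -/
noncomputable abbrev QR (F : Type*) [Field F] (N : ℕ) : Type _ :=
  Polynomial F ⧸ Ideal.span {(X : Polynomial F) ^ N - 1}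

theorem mk_X_pow_eq_one (F : Type*) [Field F] (N : ℕ) :
    (Ideal.Quotient.mk (Ideal.span {(X : Polynomial F) ^ N - 1}) (X ^ N)) = 1 := by
  have hmem : (X : Polynomial F) ^ N - 1 ∈ Ideal.span {(X : Polynomial F) ^ N - 1} :=
    Ideal.subset_span rfl
  have h0 := Ideal.Quotient.eq_zero_iff_mem.mpr hmem
  rw [map_sub, map_one, sub_eq_zero] at h0
  exact h0

/-- The image `X̄` of `X` in `F[X]/(X^N − 1)`, as a unit of that ring. -/
noncomputable def Xu (F : Type*) [Field F] (N : ℕ) (hN : 0 < N) : (QR F N)ˣ where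
  val := Ideal.Quotient.mk _ X
  inv := Ideal.Quotient.mk _ (X ^ (N - 1))
  val_inv := by
    rw [← map_mul, ← pow_succ', Nat.sub_add_cancel hN]
    exact mk_X_pow_eq_one F N
  inv_val := by
    rw [← map_mul, ← pow_succ, Nat.sub_add_cancel hN]
    exact mk_X_pow_eq_one F N

/-- The index `j·ℓ + h` as an element of `Fin (ℓ·m_A)`. -/
def idx {ℓ mA : ℕ} (j : Fin mA) (h : Fin ℓ) : Fin (ℓ * mA) :=
  ⟨(j : ℕ) * ℓ + (h : ℕ), by
    calc (j : ℕ) * ℓ + (h : ℕ) < (j : ℕ) * ℓ + ℓ := Nat.add_lt_add_left h.isLt _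
    _ = ((j : ℕ) + 1) * ℓ := by ring
    _ ≤ mA * ℓ := Nat.mul_le_mul_right ℓ j.isLt
    _ = ℓ * mA := Nat.mul_comm mA ℓ⟩

/-- The `h`-th component polynomial (of degree `< m_A·m_B`) of the serialization
`c(X) = Σ_{i,j} M_{i,j} X^{λ(i,j)}` of a codeword matrix `M`, where
`λ(i,j) = (i·a·ℓ²·m_A + j·b·m_B) mod (ℓ·m_A·m_B)` and
`c(X) = Σ_h c_h(X^ℓ)·X^h`. -/
noncomputable def serComp (F : Type*) [Field F] (ℓ mA mB : ℕ) (a b : ℤ)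
    (M : Fin mB → Fin (ℓ * mA) → F) (h : ℕ) : Polynomial F :=
  ∑ k ∈ Finset.range (mA * mB),
    C ((∑ i : Fin mB, ∑ j : Fin (ℓ * mA),
        C (M i j) * X ^ ((((i : ℤ) * a * ℓ ^ 2 * mA + (j : ℤ) * b * mB) %
          (ℓ * mA * mB : ℕ)).toNat)).coeff (k * ℓ + h)) * X ^ k

theorem idx_bijective (ℓ mA : ℕ) :
    Function.Bijective fun p : Fin mA × Fin ℓ => idx p.1 p.2 := by
  have h : (fun p : Fin mA × Fin ℓ => idx p.1 p.2) =
      finProdFinEquiv.trans (finCongr (Nat.mul_comm mA ℓ)) := by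
    funext p
    apply Fin.ext
    simp only [idx, Equiv.trans_apply, finCongr_apply, Fin.val_cast, finProdFinEquiv_apply_val]
    ring
  rw [h]
  exact Equiv.bijective _

/-- The position `λ(i, jℓ + h)` is congruent to `h` modulo `ℓ`, and its quotient by `ℓ` is
`i·a·ℓ·m_A + j·b·m_B − h·a·m_A` modulo `m_A·m_B`. -/
theorem exists_serialization_quotient {H : Type*} [Group H] {ℓ mA mB : ℕ} (hmA : 0 < mA)
    (hmB : 0 < mB) {a b : ℤ} (hab : a * ℓ * mA + b * mB = 1) (x : H)
    (hx : x ^ (mA * mB) = 1) (i j h : ℕ) (hh : h < ℓ) :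
    ∃ z < mA * mB,
      (((i : ℤ) * a * ℓ ^ 2 * mA + ((j * ℓ + h : ℕ) : ℤ) * b * mB) %
        (ℓ * mA * mB : ℕ)).toNat = z * ℓ + h ∧
      x ^ z = x ^ ((i : ℤ) * (a * ℓ * mA) + (j : ℤ) * (b * mB) + -(h : ℤ) * a * mA) := by
  have hN : (0 : ℤ) < mA * mB := by positivity
  set y : ℤ := (i : ℤ) * (a * ℓ * mA) + (j : ℤ) * (b * mB) + -(h : ℤ) * a * mA with hy
  have hnonneg : 0 ≤ y % (mA * mB : ℤ) := Int.emod_nonneg _ hN.ne'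
  obtain ⟨z, hz⟩ := Int.eq_ofNat_of_zero_le hnonneg
  have hlt : (z : ℤ) < mA * mB := hz ▸ Int.emod_lt_of_pos _ hN
  have hdiv : (z : ℤ) + mA * mB * (y / (mA * mB)) = y := by
    rw [← hz]; exact Int.emod_add_mul_ediv _ _
  refine ⟨z, by exact_mod_cast hlt, ?_, ?_⟩
  · have hval : (i : ℤ) * a * ℓ ^ 2 * mA + ((j * ℓ + h : ℕ) : ℤ) * b * mB =
        ((z * ℓ + h : ℕ) : ℤ) + ((ℓ * mA * mB : ℕ) : ℤ) * (y / (mA * mB)) := by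
      push_cast
      linear_combination (-(ℓ : ℤ)) * hdiv + (h : ℤ) * hab + (ℓ : ℤ) * hy
    have hbound : z * ℓ + h < ℓ * mA * mB := by
      have : z + 1 ≤ mA * mB := by exact_mod_cast hlt
      nlinarith
    rw [hval, Int.add_mul_emod_self_left, Int.emod_eq_of_lt (by positivity)
      (by exact_mod_cast hbound), Int.toNat_natCast]
  · have hx' : x ^ ((mA : ℤ) * mB) = 1 := by exact_mod_cast hx
    rw [← hdiv, zpow_add, zpow_mul, hx', one_zpow, mul_one, zpow_natCast]

theorem sum_range_coeff_C_mul_X_pow {R : Type*} [Semiring R] (c : R) {ℓ N z h h' : ℕ}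
    (hz : z < N) (hh : h < ℓ) (hh' : h' < ℓ) :
    ∑ k ∈ Finset.range N, C ((C c * X ^ (z * ℓ + h)).coeff (k * ℓ + h')) * X ^ k =
      if h = h' then C c * X ^ z else 0 := by
  have key (k : ℕ) : k * ℓ + h' = z * ℓ + h ↔ k = z ∧ h = h' := by
    constructor
    · intro e
      have hmod := congrArg (· % ℓ) e
      simp only [Nat.mul_add_mod', Nat.mod_eq_of_lt hh,
        Nat.mod_eq_of_lt hh'] at hmod
      subst hmod
      exact ⟨Nat.eq_of_mul_eq_mul_right (by omega) (Nat.add_right_cancel e), rfl⟩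
    · rintro ⟨rfl, rfl⟩; rfl
  simp only [coeff_C_mul_X_pow, key]
  split_ifs with e
  · simp only [e, and_true]
    rw [Finset.sum_eq_single_of_mem z (Finset.mem_range.mpr hz)]
    · simp
    · intro k _ hk
      simp [hk]
  · simp [e]

theorem Xu_pow_eq_one (F : Type*) [Field F] (N : ℕ) (hN : 0 < N) : Xu F N hN ^ N = 1 := by
  apply Units.ext
  rw [Units.val_pow_eq_pow_val]
  exact (map_pow _ _ _).symm.trans (mk_X_pow_eq_one F N)

theorem mk_serComp (F : Type*) [Field F] {ℓ mA mB : ℕ} (hmA : 0 < mA) (hmB : 0 < mB)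
    {a b : ℤ} (hab : a * ℓ * mA + b * mB = 1) (M : Fin mB → Fin (ℓ * mA) → F) (h : Fin ℓ) :
    (Ideal.Quotient.mk (Ideal.span {(X : F[X]) ^ (mA * mB) - 1}) (serComp F ℓ mA mB a b M h) :
        QR F (mA * mB)) =
      ∑ i : Fin mB, ∑ j : Fin mA, algebraMap F (QR F (mA * mB)) (M i (idx j h)) *
        ((↑(Xu F (mA * mB) (Nat.mul_pos hmA hmB) ^ (a * ℓ * mA)) : QR F (mA * mB)) ^ (i : ℕ) *
        (↑(Xu F (mA * mB) (Nat.mul_pos hmA hmB) ^ (b * mB)) : QR F (mA * mB)) ^ (j : ℕ) *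
        ↑(Xu F (mA * mB) (Nat.mul_pos hmA hmB) ^ (-((h : ℕ) : ℤ) * a * mA))) := by
  have hser : serComp F ℓ mA mB a b M h = ∑ i : Fin mB, ∑ p : Fin mA × Fin ℓ,
      ∑ k ∈ Finset.range (mA * mB), C ((C (M i (idx p.1 p.2)) *
        X ^ ((((i : ℤ) * a * ℓ ^ 2 * mA + ((idx p.1 p.2 : ℕ) : ℤ) * b * mB) %
          (ℓ * mA * mB : ℕ)).toNat)).coeff (k * ℓ + h)) * X ^ k := by
    have hre (i : Fin mB) := (idx_bijective ℓ mA).sum_comp fun j => C (M i j) *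
        (X : F[X]) ^ ((((i : ℤ) * a * ℓ ^ 2 * mA + (j : ℤ) * b * mB) %
          (ℓ * mA * mB : ℕ)).toNat)
    simp only [serComp, ← hre, finsetSum_coeff, map_sum, Finset.sum_mul]
    rw [Finset.sum_comm]
    exact Finset.sum_congr rfl fun i _ => Finset.sum_comm
  rw [hser, map_sum]
  refine Finset.sum_congr rfl fun i _ => ?_
  rw [map_sum, Fintype.sum_prod_type]
  refine Finset.sum_congr rfl fun j _ => ?_
  rw [Finset.sum_eq_single_of_mem h (Finset.mem_univ h)]
  · obtain ⟨z, hz, he, hpow⟩ := exists_serialization_quotient hmA hmB hab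
      (Xu F (mA * mB) (Nat.mul_pos hmA hmB)) (Xu_pow_eq_one F _ _) i j h h.isLt
    rw [show ((idx j h : Fin (ℓ * mA)) : ℕ) = (j : ℕ) * ℓ + (h : ℕ) from rfl, he,
      sum_range_coeff_C_mul_X_pow _ hz h.isLt h.isLt, if_pos rfl, map_mul, map_pow]
    congr 1
    have hval := congrArg Units.val hpow
    rw [Units.val_pow_eq_pow_val] at hval
    refine hval.trans ?_
    rw [zpow_add, zpow_add, mul_comm (i : ℤ), mul_comm (j : ℤ), zpow_mul _ _ (i : ℤ),
      zpow_mul _ _ (j : ℤ), zpow_natCast, zpow_natCast]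
    simp only [Units.val_mul, Units.val_pow_eq_pow_val]
  · intro h' _ hne
    obtain ⟨z, hz, he, -⟩ := exists_serialization_quotient hmA hmB hab
      (Xu F (mA * mB) (Nat.mul_pos hmA hmB)) (Xu_pow_eq_one F _ _) i j h' h'.isLt
    rw [show ((idx j h' : Fin (ℓ * mA)) : ℕ) = (j : ℕ) * ℓ + (h' : ℕ) from rfl, he,
      sum_range_coeff_C_mul_X_pow _ hz h'.isLt h.isLt, if_neg (Fin.val_ne_of_ne hne), map_zero]

theorem exists_aeval_eq_sum_of_mem_span {F S ι κ : Type*} [Field F] [CommRing S] [Algebra F S]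
    [Fintype ι] {m : ℕ} {v : S} (hv : v ^ m = 1) {G : ι → κ → F[X]} {p : κ → F[X]}
    (hp : (fun h => Ideal.Quotient.mk (Ideal.span {(X : F[X]) ^ m - 1}) (p h)) ∈
      Submodule.span F[X] (Set.range fun r : ι => fun s : κ =>
        Ideal.Quotient.mk (Ideal.span {(X : F[X]) ^ m - 1}) (G r s))) :
    ∃ q : ι → S, ∀ h, aeval v (p h) = ∑ r, q r * aeval v (G r h) := by
  obtain ⟨c, hc⟩ := (Submodule.mem_span_range_iff_exists_fun F[X]).mp hp
  refine ⟨fun r => aeval v (c r), fun h => ?_⟩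
  have hmk : Ideal.Quotient.mk (Ideal.span {(X : F[X]) ^ m - 1}) (∑ r, c r * G r h) =
      Ideal.Quotient.mk _ (p h) := by
    rw [← congrFun hc h, Finset.sum_apply, map_sum]
    rfl
  obtain ⟨d, hd⟩ := Ideal.mem_span_singleton'.mp (Ideal.Quotient.eq.mp hmk)
  have := congrArg (aeval v) hd
  simp only [map_mul, map_sub, map_pow, aeval_X, hv, map_one, sub_self, mul_zero, map_sum] at this
  exact (sub_eq_zero.mp this.symm).symm

theorem sum_coeff_modByMonic_X_pow_sub_one {F : Type*} [Field F] {m : ℕ} (hm : 0 < m)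
    (p : F[X]) :
    ∑ i : Fin m, C ((p %ₘ (X ^ m - 1)).coeff i) * X ^ (i : ℕ) = p %ₘ (X ^ m - 1) := by
  rw [Fin.sum_univ_eq_sum_range fun i => C ((p %ₘ (X ^ m - 1)).coeff i) * X ^ i]
  have hmonic : (X ^ m - 1 : F[X]).Monic := monic_X_pow_sub_C 1 hm.ne'
  have hdeg : (X ^ m - 1 : F[X]).natDegree = m := natDegree_X_pow_sub_C
  refine (as_sum_range_C_mul_X_pow' _ ?_).symm
  have := natDegree_modByMonic_lt p hmonic (fun h => by
    rw [h, natDegree_one] at hdeg; omega)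
  rwa [hdeg] at this

theorem aeval_modByMonic_X_pow_sub_one {F S : Type*} [Field F] [CommRing S] [Algebra F S]
    {m : ℕ} {u : S} (hu : u ^ m = 1) (p : F[X]) :
    aeval u (p %ₘ (X ^ m - 1)) = aeval u p :=
  aeval_modByMonic_eq_self_of_root (by simp [hu])

theorem aeval_sum_C_mul_X_pow {F S ι : Type*} [Field F] [CommRing S] [Algebra F S] [Fintype ι]
    (c : ι → F) (e : ι → ℕ) (u : S) :
    aeval u (∑ i, C (c i) * X ^ e i) = ∑ i, algebraMap F S (c i) * u ^ e i := by
  simp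

/-- The matrices whose rows lie in the quasi-cyclic code generated by the rows of `G` and whose
columns are divisible by `gB`. -/
noncomputable def productCode {F : Type*} [Field F] {ℓ mA mB : ℕ} (G : Fin ℓ → Fin ℓ → F[X])
    (gB : F[X]) : AddSubmonoid (Fin mB → Fin (ℓ * mA) → F) where
  carrier := {M | (∀ i : Fin mB,
      (fun h : Fin ℓ => Ideal.Quotient.mk (Ideal.span {(X : F[X]) ^ mA - 1})
          (∑ j : Fin mA, C (M i (idx j h)) * X ^ (j : ℕ))) ∈
        Submodule.span F[X] (Set.range fun r : Fin ℓ => fun s : Fin ℓ =>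
          Ideal.Quotient.mk (Ideal.span {(X : F[X]) ^ mA - 1}) (G r s))) ∧
    ∀ j : Fin (ℓ * mA), gB ∣ ∑ i : Fin mB, C (M i j) * X ^ (i : ℕ)}
  zero_mem' := by
    refine ⟨fun i => ?_, fun j => ?_⟩
    · simp only [Pi.zero_apply, zero_mul, Finset.sum_const_zero, map_zero]
      exact zero_mem _
    · simp
  add_mem' := by
    rintro M N ⟨hM, hM'⟩ ⟨hN, hN'⟩
    refine ⟨fun i => ?_, fun j => ?_⟩
    · simp only [Pi.add_apply, add_mul, Finset.sum_add_distrib, map_add]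
      exact add_mem (hM i) (hN i)
    · simp only [Pi.add_apply, C_add, add_mul, Finset.sum_add_distrib]
      exact dvd_add (hM' j) (hN' j)

/-- The tuple with entries `∑ i j, M i (jℓ + h) · (u ^ i · v ^ j · w h)`. -/
noncomputable def evalTuple {F S : Type*} [Field F] [CommRing S] [Algebra F S] {ℓ mA mB : ℕ}
    (u v : S) (w : Fin ℓ → S) : (Fin mB → Fin (ℓ * mA) → F) →+ (Fin ℓ → S) where
  toFun M h := ∑ i : Fin mB, ∑ j : Fin mA,
    algebraMap F S (M i (idx j h)) * (u ^ (i : ℕ) * v ^ (j : ℕ) * w h)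
  map_zero' := by
    funext h
    simp
  map_add' M N := by
    funext h
    simp [add_mul, Finset.sum_add_distrib]

section

variable {F S : Type*} [Field F] [CommRing S] [Algebra F S] {ℓ mA mB : ℕ}
  (G : Fin ℓ → Fin ℓ → F[X]) (gB : F[X]) (u v : S) (w : Fin ℓ → S)

theorem evalTuple_mem_span (hv : v ^ mA = 1) (hgB : gB ≠ 0)
    {M : Fin mB → Fin (ℓ * mA) → F} (hM : M ∈ productCode G gB) :
    evalTuple u v w M ∈ Submodule.span S
      (Set.range fun r : Fin ℓ => fun h : Fin ℓ => aeval u gB * aeval v (G r h) * w h) := by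
  obtain ⟨hrow, hcol⟩ := hM
  obtain ⟨D, hD⟩ := LinearMap.exists_leftInverse_of_injective (LinearMap.mulLeft F gB)
    (LinearMap.ker_eq_bot.mpr (mul_right_injective₀ hgB))
  choose q hq using fun i => exists_aeval_eq_sum_of_mem_span hv (hrow i)
  have hdiv (j : Fin (ℓ * mA)) : ∑ i : Fin mB, algebraMap F S (M i j) * u ^ (i : ℕ) =
      aeval u gB * ∑ i : Fin mB, algebraMap F S (M i j) * aeval u (D (X ^ (i : ℕ))) := by
    obtain ⟨d, hd⟩ := hcol j
    have hDd : D (∑ i : Fin mB, C (M i j) * X ^ (i : ℕ)) = d := by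
      rw [hd]; exact LinearMap.congr_fun hD d
    rw [← aeval_sum_C_mul_X_pow, hd, map_mul, ← hDd, map_sum, map_sum]
    congr 1
    refine Finset.sum_congr rfl fun i _ => ?_
    rw [← smul_eq_C_mul, map_smul, map_smul, Algebra.smul_def]
  rw [Submodule.mem_span_range_iff_exists_fun]
  refine ⟨fun r => ∑ i : Fin mB, aeval u (D (X ^ (i : ℕ))) * q i r, ?_⟩
  funext h
  calc _ = aeval u gB * (∑ i : Fin mB, aeval u (D (X ^ (i : ℕ))) *
        ∑ r, q i r * aeval v (G r h)) * w h := by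
        simp only [Finset.sum_apply, Pi.smul_apply, smul_eq_mul, Finset.mul_sum,
          Finset.sum_mul]
        rw [Finset.sum_comm]
        refine Finset.sum_congr rfl fun i _ => Finset.sum_congr rfl fun r _ => ?_
        ring
    _ = aeval u gB * (∑ j : Fin mA, (∑ i : Fin mB, algebraMap F S (M i (idx j h)) *
        aeval u (D (X ^ (i : ℕ)))) * v ^ (j : ℕ)) * w h := by
        simp only [← hq, aeval_sum_C_mul_X_pow, Finset.mul_sum, Finset.sum_mul]
        rw [Finset.sum_comm]
        refine Finset.sum_congr rfl fun i _ => Finset.sum_congr rfl fun r _ => ?_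
        ring
    _ = ∑ j : Fin mA, (∑ i : Fin mB, algebraMap F S (M i (idx j h)) * u ^ (i : ℕ)) *
        v ^ (j : ℕ) * w h := by
        simp only [hdiv]
        rw [Finset.mul_sum, Finset.sum_mul]
        refine Finset.sum_congr rfl fun i _ => ?_
        ring
    _ = evalTuple u v w M h := by
        simp only [evalTuple, AddMonoidHom.coe_mk, ZeroHom.coe_mk, Finset.sum_mul]
        rw [Finset.sum_comm]
        refine Finset.sum_congr rfl fun i _ => Finset.sum_congr rfl fun r _ => ?_
        ring

theorem monomial_smul_mem_map_evalTuple (hmA : 0 < mA) (hmB : 0 < mB) (hu : u ^ mB = 1)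
    (hv : v ^ mA = 1) (hgB : gB ∣ X ^ mB - 1) (r : Fin ℓ) (k : ℕ) (c : F) :
    ((algebraMap F S c * (u * v) ^ k) •
        fun h : Fin ℓ => aeval u gB * aeval v (G r h) * w h) ∈
      (productCode (mA := mA) (mB := mB) G gB).map (evalTuple u v w) := by
  let e := (Equiv.ofBijective _ (idx_bijective ℓ mA)).symm
  have he (j : Fin mA) (h : Fin ℓ) : e (idx j h) = (j, h) :=
    (Equiv.ofBijective _ (idx_bijective ℓ mA)).symm_apply_apply (j, h)
  set P : F[X] := (X ^ k * gB) %ₘ (X ^ mB - 1) with hP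
  set Q : Fin ℓ → F[X] := fun h => (X ^ k * G r h) %ₘ (X ^ mA - 1) with hQ
  have hPsum : ∑ i : Fin mB, C (P.coeff i) * X ^ (i : ℕ) = P :=
    sum_coeff_modByMonic_X_pow_sub_one hmB _
  have hQsum (h : Fin ℓ) : ∑ j : Fin mA, C ((Q h).coeff j) * X ^ (j : ℕ) = Q h :=
    sum_coeff_modByMonic_X_pow_sub_one hmA _
  refine ⟨fun i j => c * P.coeff i * (Q (e j).2).coeff (e j).1, ⟨fun i => ?_, fun j => ?_⟩, ?_⟩
  · have hQmk (h : Fin ℓ) : Ideal.Quotient.mk (Ideal.span {(X : F[X]) ^ mA - 1}) (Q h) =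
        Ideal.Quotient.mk _ (X ^ k * G r h) := by
      simp only [hQ]
      rw [Ideal.Quotient.eq, modByMonic_eq_sub_mul_div, Ideal.mem_span_singleton]
      exact ⟨-((X ^ k * G r h) /ₘ (X ^ mA - 1)), by ring⟩
    convert Submodule.smul_mem _ (C (c * P.coeff i) * X ^ k)
      (Submodule.subset_span (Set.mem_range_self r)) using 1
    funext h
    have : ∑ j : Fin mA, C (c * P.coeff i * (Q (e (idx j h)).2).coeff (e (idx j h)).1) *
        X ^ (j : ℕ) = C (c * P.coeff i) * Q h := by
      conv_rhs => rw [← hQsum, Finset.mul_sum]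
      refine Finset.sum_congr rfl fun j _ => ?_
      rw [he, C_mul (a := c * P.coeff i), mul_assoc]
    rw [this, map_mul, hQmk, ← map_mul, ← mul_assoc]
    rfl
  · have hPdvd : gB ∣ P := by
      rw [hP, modByMonic_eq_sub_mul_div]
      exact dvd_sub (dvd_mul_left _ _) (hgB.mul_right _)
    have : ∑ i : Fin mB, C (c * P.coeff i * (Q (e j).2).coeff (e j).1) * X ^ (i : ℕ) =
        C (c * (Q (e j).2).coeff (e j).1) * P := by
      conv_rhs => rw [← hPsum, Finset.mul_sum]
      refine Finset.sum_congr rfl fun i _ => ?_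
      simp only [C_mul]
      ring
    rw [this]
    exact hPdvd.mul_left _
  · funext h
    have hPu : ∑ i : Fin mB, algebraMap F S (P.coeff i) * u ^ (i : ℕ) = u ^ k * aeval u gB := by
      rw [← aeval_sum_C_mul_X_pow, hPsum, hP, aeval_modByMonic_X_pow_sub_one hu]
      simp
    have hQv : ∑ j : Fin mA, algebraMap F S ((Q h).coeff j) * v ^ (j : ℕ) =
        v ^ k * aeval v (G r h) := by
      rw [← aeval_sum_C_mul_X_pow, hQsum, hQ, aeval_modByMonic_X_pow_sub_one hv]
      simp
    calc _ = algebraMap F S c * ((∑ i : Fin mB, algebraMap F S (P.coeff i) * u ^ (i : ℕ)) *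
          ∑ j : Fin mA, algebraMap F S ((Q h).coeff j) * v ^ (j : ℕ)) * w h := by
          simp only [evalTuple, AddMonoidHom.coe_mk, ZeroHom.coe_mk, he, map_mul,
            Finset.sum_mul, Finset.mul_sum]
          refine Finset.sum_comm.trans ?_
          refine Finset.sum_congr rfl fun i _ => Finset.sum_congr rfl fun j _ => ?_
          ring
      _ = _ := by
          rw [hPu, hQv, Pi.smul_apply, smul_eq_mul]
          ring

theorem map_evalTuple_productCode (hmA : 0 < mA) (hmB : 0 < mB) (hu : u ^ mB = 1)
    (hv : v ^ mA = 1) (huv : Function.Surjective (aeval (R := F) (u * v))) (hgB0 : gB ≠ 0)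
    (hgB : gB ∣ X ^ mB - 1) :
    (productCode (mA := mA) (mB := mB) G gB).map (evalTuple u v w) =
      (Submodule.span S (Set.range fun r : Fin ℓ => fun h : Fin ℓ =>
        aeval u gB * aeval v (G r h) * w h)).toAddSubmonoid := by
  apply le_antisymm
  · rintro _ ⟨M, hM, rfl⟩
    exact evalTuple_mem_span G gB u v w hv hgB0 hM
  · intro t ht
    obtain ⟨c, rfl⟩ := (Submodule.mem_span_range_iff_exists_fun S).mp ht
    refine sum_mem fun r _ => ?_
    obtain ⟨p, hp⟩ := huv (c r)
    rw [← hp, aeval_eq_sum_range, Finset.sum_smul]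
    refine sum_mem fun k _ => ?_
    rw [Algebra.smul_def (p.coeff k)]
    exact monomial_smul_mem_map_evalTuple G gB u v w hmA hmB hu hv hgB r k _

end

/-- **Thm. (Quasi-cyclic product code).**  If the row-code `A` is the
`ℓ`-quasi-cyclic code with RGB/POT generator matrix `G` and the column-code `B`
is the cyclic code generated by `g^B`, then the component tuples of the
serialized codewords of `A ⊗ B` form exactly the `R`-submodule of `R^ℓ`
(`R = F[X]/(X^{m_A·m_B} − 1)`) generated by the rows `r_i` with `j`-th entry
`g^B(u)·g_{i,j}(v)·w^{−j}`, where `u = X̄^{a·ℓ·m_A}`, `v = X̄^{b·m_B}`,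
`w = X̄^{a·m_A}`. -/
theorem quasi_cyclic_product_code_generating_set (F : Type*) [Field F] [Fintype F]
    (ℓ mA mB : ℕ) (hℓ : 1 ≤ ℓ) (hmA : 1 ≤ mA) (hmB : 1 ≤ mB)
    (hgcd : Nat.gcd (ℓ * mA) mB = 1) (a b : ℤ) (hab : a * ℓ * mA + b * mB = 1)
    (G : Fin ℓ → Fin ℓ → Polynomial F)
    (hG1 : ∀ i j : Fin ℓ, j < i → G i j = 0)
    (hG2 : ∀ i j : Fin ℓ, j < i → (G j i).degree < (G i i).degree)
    (hG3 : ∀ i : Fin ℓ, G i i ∣ X ^ mA - 1)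
    (hG4 : ∀ i j : Fin ℓ, G i i = X ^ mA - 1 → i < j → G i j = 0)
    (gB : Polynomial F) (hgB : gB ∣ X ^ mB - 1)
    (T : Set (Fin ℓ → QR F (mA * mB)))
    (hT : T = {t | ∃ M : Fin mB → Fin (ℓ * mA) → F,
      (∀ i : Fin mB,
        (fun h : Fin ℓ => Ideal.Quotient.mk (Ideal.span {(X : Polynomial F) ^ mA - 1})
            (∑ j : Fin mA, C (M i (idx j h)) * X ^ (j : ℕ))) ∈
          Submodule.span (Polynomial F)
            (Set.range fun r : Fin ℓ => fun s : Fin ℓ =>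
              Ideal.Quotient.mk (Ideal.span {(X : Polynomial F) ^ mA - 1}) (G r s))) ∧
      (∀ j : Fin (ℓ * mA), gB ∣ ∑ i : Fin mB, C (M i j) * X ^ (i : ℕ)) ∧
      ∀ h : Fin ℓ, t h = Ideal.Quotient.mk (Ideal.span {(X : Polynomial F) ^ (mA * mB) - 1})
        (serComp F ℓ mA mB a b M (h : ℕ))}) :
    T = (Submodule.span (QR F (mA * mB))
      (Set.range fun i : Fin ℓ => fun j : Fin ℓ =>
        Polynomial.aeval
            (↑(Xu F (mA * mB) (Nat.mul_pos hmA hmB) ^ (a * ℓ * mA)) : QR F (mA * mB)) gB *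
          Polynomial.aeval
            (↑(Xu F (mA * mB) (Nat.mul_pos hmA hmB) ^ (b * mB)) : QR F (mA * mB)) (G i j) *
          ↑(Xu F (mA * mB) (Nat.mul_pos hmA hmB) ^ (-((j : ℕ) : ℤ) * a * mA))) :
      Set (Fin ℓ → QR F (mA * mB))) := by
  set x := Xu F (mA * mB) (Nat.mul_pos hmA hmB) with hx_def
  have hx : x ^ ((mA : ℤ) * mB) = 1 := by exact_mod_cast Xu_pow_eq_one F _ _
  have hu : (↑(x ^ (a * ℓ * mA)) : QR F (mA * mB)) ^ mB = 1 := by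
    rw [← Units.val_pow_eq_pow_val, ← zpow_natCast, ← zpow_mul,
      show a * ℓ * mA * (mB : ℤ) = mA * mB * (a * ℓ) by ring, zpow_mul, hx, one_zpow,
      Units.val_one]
  have hv : (↑(x ^ (b * mB)) : QR F (mA * mB)) ^ mA = 1 := by
    rw [← Units.val_pow_eq_pow_val, ← zpow_natCast, ← zpow_mul,
      show b * mB * (mA : ℤ) = mA * mB * b by ring, zpow_mul, hx, one_zpow, Units.val_one]
  have huv : Function.Surjective (aeval (R := F)
      ((↑(x ^ (a * ℓ * mA)) : QR F (mA * mB)) * ↑(x ^ (b * mB)))) := by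
    rw [← Units.val_mul, ← zpow_add, hab, zpow_one]
    intro s
    obtain ⟨p, rfl⟩ := Ideal.Quotient.mk_surjective s
    refine ⟨p, ?_⟩
    exact (aeval_algHom_apply (Ideal.Quotient.mkₐ F (Ideal.span {(X : F[X]) ^ (mA * mB) - 1})) X p).trans (by
      rw [aeval_X_left_apply]; rfl)
  have hgB0 : gB ≠ 0 := ne_zero_of_dvd_ne_zero (X_pow_sub_C_ne_zero hmB 1) hgB
  have hmap := map_evalTuple_productCode (mA := mA) (mB := mB) G gB _ _
    (fun h : Fin ℓ => (↑(x ^ (-((h : ℕ) : ℤ) * a * mA)) : QR F (mA * mB)))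
    hmA hmB hu hv huv hgB0 hgB
  rw [hT]
  refine Eq.trans ?_ (congrArg (SetLike.coe (A := AddSubmonoid _)) hmap)
  ext t
  constructor
  · rintro ⟨M, hrow, hcol, ht⟩
    exact ⟨M, ⟨hrow, hcol⟩, funext fun h => ((ht h).trans (mk_serComp F hmA hmB hab M h)).symm⟩
  · rintro ⟨M, ⟨hrow, hcol⟩, rfl⟩
    exact ⟨M, hrow, hcol, fun h => (mk_serComp F hmA hmB hab M h).symm⟩
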